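/- Suppose f11 is identically zero and f31′ is nowhere zero. Assume the structure equations (S1)–(S3) hold and ∂F/∂z_k is nowhere zero. Then there exist no smooth functions a, b, c on any nonempty open set U ⊆ ℝ² satisfying the Codazzi identities (C1), (C2) and the Gauss equation a·c − b² = −1. -/

import Mathlib

open Real Finset

/-- Partial derivative of `f` at `z` in the `i`-th coordinate direction. -/
noncomputable def pd {n : ℕ} (f : (Fin n → ℝ) → ℝ) (z : Fin n → ℝ) (i : ℕ) : ℝ :=
  fderiv ℝ f z (fun j => if (j : ℕ) = i then 1 else 0)

/-- The `i`-th coordinate of `z` (junk value `0` out of range). -/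
def zc {n : ℕ} (z : Fin n → ℝ) (i : ℕ) : ℝ :=
  if h : i < n then z ⟨i, h⟩ else 0

/-- `f` depends only on the first `m` coordinates `z_0, …, z_{m-1}`. -/
def DependsOnFirst {n : ℕ} (m : ℕ) (f : (Fin n → ℝ) → ℝ) : Prop :=
  ∀ z w : Fin n → ℝ, (∀ j : Fin n, (j : ℕ) < m → z j = w j) → f z = f w

/-- The structure equations (S1)–(S3), required at every point `(z_0, …, z_k) ∈ ℝ^{k+1}`. -/
def StructEqs (k : ℕ) (η : ℝ) (f11 f31 : ℝ → ℝ)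
    (f12 f22 f32 F : (Fin (k+1) → ℝ) → ℝ) : Prop :=
  ∀ z : Fin (k+1) → ℝ,
    deriv f11 (z 0) * F z =
      (∑ i ∈ Finset.range k, pd f12 z i * zc z (i+1)) + η * f32 z - f31 (z 0) * f22 z ∧
    (∑ i ∈ Finset.range (k-1), pd f22 z i * zc z (i+1)) =
      f11 (z 0) * f32 z - f31 (z 0) * f12 z ∧
    deriv f31 (z 0) * F z =
      (∑ i ∈ Finset.range k, pd f32 z i * zc z (i+1)) + η * f12 z - f11 (z 0) * f22 z

/-- The Codazzi identities (C1) and (C2), required for every `(x,t) ∈ U` and every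
`(z_0, …, z_{k-1})` (equivalently, every `z ∈ ℝ^{k+1}` since the data does not
depend on `z_k`).  Here `(1,0)` is the `∂/∂x` direction and `(0,1)` the `∂/∂t` one. -/
def Codazzi (k : ℕ) (η : ℝ) (f11 f31 : ℝ → ℝ) (f12 f22 f32 : (Fin (k+1) → ℝ) → ℝ)
    (U : Set (ℝ × ℝ)) (a b c : ℝ × ℝ → ℝ) : Prop :=
  ∀ p ∈ U, ∀ z : Fin (k+1) → ℝ,
    f11 (z 0) * fderiv ℝ a p (0, 1) + η * fderiv ℝ b p (0, 1)
      - f12 z * fderiv ℝ a p (1, 0) - f22 z * fderiv ℝ b p (1, 0)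
      - 2 * b p * (f11 (z 0) * f32 z - f31 (z 0) * f12 z)
      + (a p - c p) * (η * f32 z - f31 (z 0) * f22 z) = 0 ∧
    f11 (z 0) * fderiv ℝ b p (0, 1) + η * fderiv ℝ c p (0, 1)
      - f12 z * fderiv ℝ b p (1, 0) - f22 z * fderiv ℝ c p (1, 0)
      + (a p - c p) * (f11 (z 0) * f32 z - f31 (z 0) * f12 z)
      + 2 * b p * (η * f32 z - f31 (z 0) * f22 z) = 0

/-- The `i`-th coordinate direction of `ℝⁿ` (zero out of range). -/
def coordDir (n i : ℕ) : Fin n → ℝ := fun j => if (j : ℕ) = i then 1 else 0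

lemma hasDerivAt_add_smul_coordDir {n : ℕ} {f : (Fin n → ℝ) → ℝ} (hf : Differentiable ℝ f)
    (z : Fin n → ℝ) (i : ℕ) (r : ℝ) :
    HasDerivAt (fun r : ℝ => f (z + r • coordDir n i)) (pd f (z + r • coordDir n i) i) r := by
  have hline : HasDerivAt (fun r : ℝ => z + r • coordDir n i) (coordDir n i) r := by
    simpa using ((hasDerivAt_id r).smul_const (coordDir n i)).const_add z
  exact (hf _).hasFDerivAt.comp_hasDerivAt r hline

lemma exists_ne_of_pd_ne_zero {n : ℕ} {f : (Fin n → ℝ) → ℝ} (hf : Differentiable ℝ f)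
    {z : Fin n → ℝ} {i : ℕ} (h : pd f z i ≠ 0) :
    ∃ r : ℝ, f (z + r • coordDir n i) ≠ f z := by
  by_contra! hconst
  have hd := hasDerivAt_add_smul_coordDir hf z i 0
  simp only [hconst, zero_smul, add_zero] at hd
  exact h (hd.unique (hasDerivAt_const 0 (f z)))

lemma apply_add_smul_coordDir_of_pd_eq_zero {n : ℕ} {f : (Fin n → ℝ) → ℝ}
    (hf : Differentiable ℝ f) {i : ℕ} (h : ∀ z, pd f z i = 0) (z : Fin n → ℝ) (r : ℝ) :
    f (z + r • coordDir n i) = f z := by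
  have hconst := is_const_of_deriv_eq_zero
    (fun r => (hasDerivAt_add_smul_coordDir hf z i r).differentiableAt)
    (fun r => (hasDerivAt_add_smul_coordDir hf z i r).deriv.trans (h _)) r 0
  simpa using hconst

lemma DependsOnFirst.apply_add_smul_coordDir {n m : ℕ} {f : (Fin n → ℝ) → ℝ}
    (hf : DependsOnFirst m f) {i : ℕ} (hi : m ≤ i) (z : Fin n → ℝ) (r : ℝ) :
    f (z + r • coordDir n i) = f z :=
  hf _ _ fun j hj => by simp [coordDir, (hj.trans_le hi).ne]

lemma DependsOnFirst.pd_add_smul_coordDir {n m : ℕ} {f : (Fin n → ℝ) → ℝ}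
    (hf : DependsOnFirst m f) {i : ℕ} (hi : m ≤ i) (z : Fin n → ℝ) (r : ℝ) (l : ℕ) :
    pd f (z + r • coordDir n i) l = pd f z l := by
  unfold pd
  rw [← fderiv_comp_add_right, funext fun w => hf.apply_add_smul_coordDir hi w r]

lemma add_smul_coordDir_zero {n i : ℕ} (hi : i ≠ 0) (z : Fin (n + 1) → ℝ) (r : ℝ) :
    (z + r • coordDir (n + 1) i) 0 = z 0 := by
  simp [coordDir, hi.symm]

/-- A total derivative of a function of `z_0, …, z_{k-1}` is affine in `z_k`. -/
lemma DependsOnFirst.sum_pd_mul_zc_add_smul_coordDir {k : ℕ} (hk : 1 ≤ k)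
    {f : (Fin (k + 1) → ℝ) → ℝ} (hf : DependsOnFirst k f) (z : Fin (k + 1) → ℝ) (r : ℝ) :
    ∑ i ∈ Finset.range k, pd f (z + r • coordDir (k + 1) k) i *
        zc (z + r • coordDir (k + 1) k) (i + 1) =
      (∑ i ∈ Finset.range k, pd f z i * zc z (i + 1)) + pd f z (k - 1) * r := by
  obtain ⟨m, rfl⟩ := Nat.exists_eq_add_of_le' hk
  simp only [hf.pd_add_smul_coordDir le_rfl, Finset.sum_range_succ, Nat.add_sub_cancel]
  have hlow : ∀ i ∈ Finset.range m,
      pd f z i * zc (z + r • coordDir (m + 1 + 1) (m + 1)) (i + 1) =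
        pd f z i * zc z (i + 1) := by
    intro i hi
    have hi' : i < m := Finset.mem_range.mp hi
    simp [zc, coordDir, hi'.ne]
  rw [Finset.sum_congr rfl hlow]
  simp [zc, coordDir]
  ring

/-- Proposition 3(i) of the paper.  If `f11 ≡ 0` and `f31'` is nowhere
zero, then under the structure equations with `∂F/∂z_k` nowhere zero, no smooth
`a, b, c` on a nonempty open set satisfy the Codazzi identities and the Gauss equation. -/
theorem stmt5 (k : ℕ) (hk : 2 ≤ k) (η : ℝ) (hη : η ≠ 0)
    (f11 f31 : ℝ → ℝ) (f12 f22 f32 F : (Fin (k+1) → ℝ) → ℝ)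
    (hf11 : ContDiff ℝ (⊤ : ℕ∞) f11) (hf31 : ContDiff ℝ (⊤ : ℕ∞) f31)
    (hf12 : ContDiff ℝ (⊤ : ℕ∞) f12) (hf22 : ContDiff ℝ (⊤ : ℕ∞) f22)
    (hf32 : ContDiff ℝ (⊤ : ℕ∞) f32) (hF : ContDiff ℝ (⊤ : ℕ∞) F)
    (hdep12 : DependsOnFirst k f12) (hdep32 : DependsOnFirst k f32)
    (hdep22 : DependsOnFirst (k-1) f22)
    (h11 : ∀ z0 : ℝ, f11 z0 = 0) (h31d : ∀ z0 : ℝ, deriv f31 z0 ≠ 0)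
    (hS : StructEqs k η f11 f31 f12 f22 f32 F)
    (hFk : ∀ z : Fin (k+1) → ℝ, pd F z k ≠ 0) :
    ¬ ∃ (U : Set (ℝ × ℝ)) (a b c : ℝ × ℝ → ℝ),
      U.Nonempty ∧ IsOpen U ∧
      ContDiffOn ℝ (⊤ : ℕ∞) a U ∧ ContDiffOn ℝ (⊤ : ℕ∞) b U ∧
      ContDiffOn ℝ (⊤ : ℕ∞) c U ∧
      Codazzi k η f11 f31 f12 f22 f32 U a b c ∧
      (∀ p ∈ U, a p * c p - (b p) ^ 2 = -1) := by
  rintro ⟨U, a, b, c, ⟨p, hp⟩, -, -, -, -, hC, hG⟩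
  have hk1 : 1 ≤ k := by omega
  have d12 := hf12.differentiable (by simp)
  have d32 := hf32.differentiable (by simp)
  have d11 : deriv f11 = 0 := by ext x; simp [funext h11]
  have hpd12 : ∀ z, pd f12 z (k - 1) = 0 := by
    intro z
    have h0 := (hS z).1
    have h1 := (hS (z + (1 : ℝ) • coordDir (k + 1) k)).1
    rw [hdep12.sum_pd_mul_zc_add_smul_coordDir hk1, add_smul_coordDir_zero (by omega),
      hdep32.apply_add_smul_coordDir le_rfl, hdep22.apply_add_smul_coordDir (by omega)] at h1
    simp only [d11, Pi.zero_apply, zero_mul] at h0 h1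
    linarith
  have hpd32 : pd f32 0 (k - 1) ≠ 0 := by
    intro hzero
    obtain ⟨r, hr⟩ := exists_ne_of_pd_ne_zero (hF.differentiable (by simp)) (hFk 0)
    have h0 := (hS 0).2.2
    have h1 := (hS (0 + r • coordDir (k + 1) k)).2.2
    rw [hdep32.sum_pd_mul_zc_add_smul_coordDir hk1, add_smul_coordDir_zero (by omega),
      hdep12.apply_add_smul_coordDir le_rfl, hdep22.apply_add_smul_coordDir (by omega),
      hzero, zero_mul, add_zero, ← h0] at h1
    exact hr (mul_left_cancel₀ (h31d _) h1)
  obtain ⟨r, hr⟩ := exists_ne_of_pd_ne_zero d32 hpd32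
  obtain ⟨h1, h2⟩ := hC p hp 0
  obtain ⟨h1', h2'⟩ := hC p hp (0 + r • coordDir (k + 1) (k - 1))
  rw [add_smul_coordDir_zero (by omega), apply_add_smul_coordDir_of_pd_eq_zero d12 hpd12,
    hdep22.apply_add_smul_coordDir le_rfl] at h1' h2'
  simp only [h11] at h1 h2 h1' h2'
  have hne : η * (f32 (0 + r • coordDir (k + 1) (k - 1)) - f32 0) ≠ 0 :=
    mul_ne_zero hη (sub_ne_zero.mpr hr)
  have hac : a p - c p = 0 :=
    (mul_eq_zero.mp (by linear_combination h1' - h1)).resolve_right hne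
  have hb : 2 * b p = 0 :=
    (mul_eq_zero.mp (by linear_combination h2' - h2)).resolve_right hne
  have hgauss := hG p hp
  rw [← sub_eq_zero.mp hac, show b p = 0 by linarith] at hgauss
  nlinarith [sq_nonneg (a p)]
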